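/- arXiv:2101.00748 — 2 statements merged into one kernel-verified Lean document; each statement's English description precedes it below -/
import Mathlib

section
/- Let T be a tree with r+1 vertices (hence r edges), r ≥ 1, and let ε > 0. There exists Q, depending only on d, r and ε, such that for every q ≥ Q the following holds: if |E| > q^{(d+1)/2 + ε}, then there is a subset E' ⊆ E with |E \ E'| ≤ 2q^{-2ε/(r+1)}|E| such that, letting n_T denote the number of maps σ from the vertex set of T to E' satisfying σ(u)·σ(v) = t for every edge {u,v} of T, one has |n_T - |E|^{r+1}/q^r| ≤ 8·(|E|^{r+1}/q^r)·q^{-2ε/(r+1)}. -/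
open Finset
open scoped Classical

/-- The number of maps `σ` from the vertex set of the graph `T` into `E'` such that
`σ u · σ v = t` for every edge `{u,v}` of `T`, where `x·y = x₁y₁ + ⋯ + x_dy_d`. -/
noncomputable def treeCountProd (F : Type) [Field F] [Fintype F] [DecidableEq F]
    (d : ℕ) (t : F) (V : Type) [Fintype V] [DecidableEq V] (T : SimpleGraph V)
    (E' : Finset (Fin d → F)) : ℕ :=
  (Finset.univ.filter (fun σ : V → (Fin d → F) =>
    (∀ v, σ v ∈ E') ∧ ∀ u v, T.Adj u v → ∑ j, σ u j * σ v j = t)).card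


section S
variable {F : Type} [Field F] [Fintype F]

theorem aux_pair {d : ℕ} (t : F) (ht : t ≠ 0) (y y' : Fin d → F) (hy : y ≠ y') :
    (univ.filter (fun x : Fin d → F => x ⬝ᵥ y = t ∧ x ⬝ᵥ y' = t)).card * Fintype.card F ^ 2
      ≤ Fintype.card F ^ d := by
  set S := univ.filter (fun x : Fin d → F => x ⬝ᵥ y = t ∧ x ⬝ᵥ y' = t) with hS
  rcases S.eq_empty_or_nonempty with h | ⟨x0, hx0⟩
  · rw [h]; simp
  have hx0' : x0 ⬝ᵥ y = t ∧ x0 ⬝ᵥ y' = t := by simpa [hS] using hx0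
  obtain ⟨j, hj⟩ : ∃ j, y j ≠ y' j := by
    by_contra hcon
    push Not at hcon
    exact hy (funext hcon)
  have hj' : y j - y' j ≠ 0 := sub_ne_zero.mpr hj
  have hcard : (S ×ˢ (univ : Finset (F × F))).card ≤ (univ : Finset (Fin d → F)).card := by
    apply card_le_card_of_injOn
      (fun p => p.1 + Pi.single j p.2.1 + p.2.2 • x0) (fun _ _ => by simp)
    rintro ⟨x, a, b⟩ hx ⟨x', a', b'⟩ hx' heq
    simp only [hS, coe_product, Set.mem_prod, mem_coe, mem_filter, mem_univ, true_and,
      and_true, coe_univ, Set.mem_univ] at hx hx'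
    simp only at heq
    have e1 := congrArg (fun v => v ⬝ᵥ y) heq
    have e2 := congrArg (fun v => v ⬝ᵥ y') heq
    simp only [add_dotProduct, smul_dotProduct, single_dotProduct, hx.1, hx.2, hx'.1, hx'.2,
      hx0'.1, hx0'.2, smul_eq_mul] at e1 e2
    have ea : a = a' := by
      have : (a - a') * (y j - y' j) = 0 := by linear_combination e1 - e2
      rcases mul_eq_zero.mp this with h | h
      · exact sub_eq_zero.mp h
      · exact absurd h hj'
    subst ea
    have eb : b = b' := by
      have : (b - b') * t = 0 := by linear_combination e1
      rcases mul_eq_zero.mp this with h | h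
      · exact sub_eq_zero.mp h
      · exact absurd h ht
    subst eb
    simpa using heq
  simpa [card_product, sq] using hcard

theorem aux_single {d : ℕ} (t : F) (y : Fin d → F) (hy : y ≠ 0) :
    (univ.filter (fun x : Fin d → F => x ⬝ᵥ y = t)).card * Fintype.card F
      = Fintype.card F ^ d := by
  set S := univ.filter (fun x : Fin d → F => x ⬝ᵥ y = t) with hS
  obtain ⟨j, hj⟩ : ∃ j, y j ≠ 0 := by
    by_contra hcon
    push Not at hcon
    exact hy (funext hcon)
  have hcard : (S ×ˢ (univ : Finset F)).card = (univ : Finset (Fin d → F)).card := by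
    apply card_bij (fun p _ => p.1 + Pi.single j p.2) (fun _ _ => by simp)
    · rintro ⟨x, a⟩ hx ⟨x', a'⟩ hx' heq
      simp only [hS, mem_product, mem_filter, mem_univ, true_and, and_true] at hx hx'
      simp only at heq
      have e1 := congrArg (fun v => v ⬝ᵥ y) heq
      simp only [add_dotProduct, single_dotProduct, hx, hx'] at e1
      have ea : a = a' := by
        have : (a - a') * y j = 0 := by linear_combination e1
        rcases mul_eq_zero.mp this with h | h
        · exact sub_eq_zero.mp h
        · exact absurd h hj
      subst ea
      simpa using heq
    · intro z _
      refine ⟨(z - Pi.single j ((z ⬝ᵥ y - t) / y j), (z ⬝ᵥ y - t) / y j), ?_, ?_⟩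
      · simp [hS, sub_dotProduct, single_dotProduct, hj]
      · simp
  simpa [card_product] using hcard

theorem aux_mixing {d : ℕ} (hd : 2 ≤ d) (t : F) (ht : t ≠ 0) (S : Finset (Fin d → F)) :
    ∑ x : Fin d → F, (((S.filter (fun y => x ⬝ᵥ y = t)).card : ℝ)
        - (S.card : ℝ) / (Fintype.card F : ℝ)) ^ 2
      ≤ (S.card : ℝ) * (Fintype.card F : ℝ) ^ (d - 1) := by
  obtain ⟨e, rfl⟩ : ∃ e, d = e + 2 := ⟨d - 2, by omega⟩
  set q : ℝ := (Fintype.card F : ℝ) with hq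
  have hq1 : 1 ≤ q := by
    have : 1 ≤ Fintype.card F := Fintype.card_pos
    rw [hq]; exact_mod_cast this
  have hq0 : q ≠ 0 := by positivity
  let I : (Fin (e+2) → F) → (Fin (e+2) → F) → ℝ := fun x y => if x ⬝ᵥ y = t then 1 else 0
  have hP : ∀ y, ∑ x, I x y = ((univ.filter (fun x : Fin (e+2) → F => x ⬝ᵥ y = t)).card : ℝ) := by
    intro y; simp [I]
  have hP1 : ∀ y, y ≠ 0 → ∑ x, I x y = q ^ (e+1) := by
    intro y hy
    have h := aux_single t y hy
    have h2 : (∑ x, I x y) * q = q ^ (e+2) := by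
      rw [hP, hq]; exact_mod_cast h
    apply mul_right_cancel₀ hq0
    rw [h2]; ring
  have hP0 : ∑ x, I x 0 = 0 := by
    simp [I, Ne.symm ht]
  have hII : ∀ x y, I x y * I x y = I x y := by
    intro x y; simp [I]
  have hPP : ∀ y y', y ≠ y' → ∑ x, I x y * I x y' ≤ q ^ e := by
    intro y y' hy
    have h := aux_pair t ht y y' hy
    have h1 : ∑ x, I x y * I x y' = ((univ.filter
        (fun x : Fin (e+2) → F => x ⬝ᵥ y = t ∧ x ⬝ᵥ y' = t)).card : ℝ) := by
      rw [Finset.card_filter]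
      push_cast
      refine Finset.sum_congr rfl fun x _ => ?_
      simp only [I]
      split_ifs <;> simp_all
    have h2 : (∑ x, I x y * I x y') * q ^ 2 ≤ q ^ (e+2) := by
      rw [h1, hq]; exact_mod_cast h
    have h3 : q ^ (e+2) = q ^ e * q ^ 2 := by ring
    rw [h3] at h2
    exact le_of_mul_le_mul_right h2 (by positivity)
  have hone : ∑ _x : Fin (e+2) → F, (1:ℝ) = q ^ (e+2) := by
    simp [hq]
  have hK : ∀ y y', ∑ x, (I x y - 1 / q) * (I x y' - 1 / q) ≤ if y = y' then q ^ (e+1) else 0 := by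
    intro y y'
    have hexp : ∑ x, (I x y - 1 / q) * (I x y' - 1 / q)
        = ∑ x, I x y * I x y' - (∑ x, I x y) / q - (∑ x, I x y') / q + q ^ e := by
      have : q ^ e = (1 / q ^ 2) * ∑ _x : Fin (e+2) → F, (1:ℝ) := by
        rw [hone]; field_simp; ring
      rw [this, Finset.sum_div, Finset.sum_div, Finset.mul_sum, ← Finset.sum_sub_distrib,
        ← Finset.sum_sub_distrib, ← Finset.sum_add_distrib]
      refine Finset.sum_congr rfl fun x _ => ?_
      field_simp
      ring
    rw [hexp]
    have hdiv : q ^ (e+1) / q = q ^ e := by rw [pow_succ]; field_simp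
    have hle : q ^ e ≤ q ^ (e+1) := pow_le_pow_right₀ hq1 (by omega)
    have hpos : 0 ≤ q ^ e := by positivity
    split_ifs with h
    · subst h
      simp only [hII]
      by_cases hy : y = 0
      · subst hy; rw [hP0]; simpa using hle
      · rw [hP1 y hy, hdiv]; linarith
    · by_cases hy : y = 0
      · subst hy
        have hz : ∀ x, I x 0 = 0 := by intro x; simp [I, Ne.symm ht]
        rw [hP1 y' (Ne.symm h), hdiv]
        simp [hz]
      · by_cases hy' : y' = 0
        · subst hy'
          have hz : ∀ x, I x 0 = 0 := by intro x; simp [I, Ne.symm ht]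
          rw [hP1 y hy, hdiv]
          simp [hz]
        · rw [hP1 y hy, hP1 y' hy', hdiv]
          linarith [hPP y y' h]
  have hnu : ∀ x, (((S.filter (fun y => x ⬝ᵥ y = t)).card : ℝ) - (S.card : ℝ) / q)
      = ∑ y ∈ S, (I x y - 1 / q) := by
    intro x
    rw [Finset.sum_sub_distrib, Finset.card_filter]
    simp [I, div_eq_mul_inv]
  calc _ = ∑ x, ∑ y ∈ S, ∑ y' ∈ S, (I x y - 1 / q) * (I x y' - 1 / q) := by
        refine Finset.sum_congr rfl fun x _ => ?_
        rw [hnu, sq, Finset.sum_mul_sum]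
    _ = ∑ y ∈ S, ∑ y' ∈ S, ∑ x, (I x y - 1 / q) * (I x y' - 1 / q) := by
        rw [Finset.sum_comm]
        refine Finset.sum_congr rfl fun y _ => ?_
        rw [Finset.sum_comm]
    _ ≤ ∑ y ∈ S, ∑ y' ∈ S, (if y = y' then q ^ (e+1) else 0) :=
        Finset.sum_le_sum fun y _ => Finset.sum_le_sum fun y' _ => hK y y'
    _ = _ := by
        simp [Finset.sum_ite_eq]
end S

section T
variable {X : Type} [Fintype X]

noncomputable def homSet (R : X → X → Prop) (S : Finset X) {V : Type} [Fintype V]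
    (T : SimpleGraph V) : Finset (V → X) :=
  univ.filter (fun σ : V → X => (∀ v, σ v ∈ S) ∧ ∀ u v, T.Adj u v → R (σ u) (σ v))

theorem mem_homSet (R : X → X → Prop) (S : Finset X) {V : Type} [Fintype V]
    (T : SimpleGraph V) (σ : V → X) :
    σ ∈ homSet R S T ↔ (∀ v, σ v ∈ S) ∧ ∀ u v, T.Adj u v → R (σ u) (σ v) := by
  simp only [homSet, mem_filter, mem_univ, true_and]

theorem homSet_peel (R : X → X → Prop) (hR : ∀ x y, R x y → R y x) (S : Finset X)
    {V : Type} [Fintype V] (T : SimpleGraph V) (v w : V) (hw : w ≠ v) (hvw : T.Adj v w)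
    (huniq : ∀ z, T.Adj v z → z = w) (φ : ({j // j ≠ v} → X) → ℝ) :
    ∑ σ ∈ homSet R S T, φ (fun j => σ j.1)
      = ∑ σ ∈ homSet R S (T.comap (Subtype.val : {j // j ≠ v} → V)),
          φ σ * ((S.filter (fun y => R (σ ⟨w, hw⟩) y)).card : ℝ) := by
  unfold homSet
  rw [Finset.sum_filter, Finset.sum_filter, ← Equiv.sum_comp (Equiv.funSplitAt v X).symm,
    Fintype.sum_prod_type_right]
  refine Finset.sum_congr (by ext; simp) fun σ _ => ?_
  have hval : ∀ (y : X), (Equiv.funSplitAt v X).symm (y, σ) v = y := by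
    intro y; simp [Equiv.funSplitAt, Equiv.piSplitAt]
  have hval' : ∀ (y : X) (j : V) (hj : j ≠ v), (Equiv.funSplitAt v X).symm (y, σ) j = σ ⟨j, hj⟩ := by
    intro y j hj; simp [Equiv.funSplitAt, Equiv.piSplitAt, hj]
  have hfun : ∀ y : X, (fun j : {j // j ≠ v} => (Equiv.funSplitAt v X).symm (y, σ) j.1) = σ := by
    intro y; funext j; exact hval' y j.1 j.2
  have hiff : ∀ y : X, ((∀ a, (Equiv.funSplitAt v X).symm (y, σ) a ∈ S) ∧
      ∀ a b, T.Adj a b → R ((Equiv.funSplitAt v X).symm (y, σ) a)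
        ((Equiv.funSplitAt v X).symm (y, σ) b)) ↔
      (((∀ a, σ a ∈ S) ∧ ∀ a b, (T.comap (Subtype.val : {j // j ≠ v} → V)).Adj a b →
        R (σ a) (σ b)) ∧ (y ∈ S ∧ R (σ ⟨w, hw⟩) y)) := by
    intro y
    constructor
    · rintro ⟨h1, h2⟩
      refine ⟨⟨fun a => ?_, fun a b hab => ?_⟩, ?_, ?_⟩
      · have := h1 a.1; rwa [hval' y a.1 a.2] at this
      · have := h2 a.1 b.1 hab
        rwa [hval' y a.1 a.2, hval' y b.1 b.2] at this
      · have := h1 v; rwa [hval] at this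
      · have := h2 w v hvw.symm
        rwa [hval, hval' y w hw] at this
    · rintro ⟨⟨h1, h2⟩, h3, h4⟩
      refine ⟨fun a => ?_, fun a b hab => ?_⟩
      · by_cases ha : a = v
        · subst ha; rwa [hval]
        · rw [hval' y a ha]; exact h1 _
      · by_cases ha : a = v
        · subst ha
          have hb := huniq b hab
          subst hb
          rw [hval, hval' y b hw]; exact hR _ _ h4
        · by_cases hb : b = v
          · subst hb
            have ha' := huniq a hab.symm
            subst ha'
            rw [hval, hval' y a hw]; exact h4
          · rw [hval' y a ha, hval' y b hb]
            exact h2 ⟨a, ha⟩ ⟨b, hb⟩ hab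
  simp only [hiff, hfun]
  split_ifs with hc
  · simp only [and_iff_right hc]
    rw [← Finset.sum_filter, Finset.sum_const, nsmul_eq_mul, mul_comm]
    congr 3
    ext y; simp
  · exact Finset.sum_eq_zero fun y _ => if_neg fun h => hc h.1

theorem tree_leaf {V : Type} [Fintype V] (T : SimpleGraph V) (hT : T.IsTree) (k : ℕ)
    (hk : Fintype.card V = k + 2) (u : V) :
    ∃ v w : V, v ≠ u ∧ w ≠ v ∧ T.Adj v w ∧ (∀ z, T.Adj v z → z = w) ∧
      (T.comap (Subtype.val : {j // j ≠ v} → V)).IsTree ∧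
      Fintype.card {j // j ≠ v} = k + 1 := by
  have : Nontrivial V := Fintype.one_lt_card_iff_nontrivial.mp (by omega)
  obtain ⟨a, b, hab, ha, hb⟩ := hT.exists_ne_and_degree_eq_one
  obtain ⟨v, hvu, hv⟩ : ∃ v, v ≠ u ∧ T.degree v = 1 := by
    by_cases h : a = u
    · exact ⟨b, fun h' => hab (h.trans h'.symm), hb⟩
    · exact ⟨a, h, ha⟩
  obtain ⟨w, hw, hwu⟩ := SimpleGraph.degree_eq_one_iff_existsUnique_adj.mp hv
  refine ⟨v, w, hvu, hw.ne', hw, hwu, ?_, ?_⟩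
  · have h1 := hT.connected.induce_compl_singleton_of_degree_eq_one hv
    have h2 := hT.isAcyclic.induce {v}ᶜ
    exact ⟨h1, h2⟩
  · rw [Fintype.card_subtype_compl, hk]; simp

theorem homSet_fiber (R : X → X → Prop) (hR : ∀ x y, R x y → R y x) (S : Finset X)
    (D : ℝ) (hD0 : 0 ≤ D) (hD : ∀ x ∈ S, ((S.filter (fun y => R x y)).card : ℝ) ≤ D) (k : ℕ) :
    ∀ (V : Type) [Fintype V] (T : SimpleGraph V), T.IsTree → Fintype.card V = k + 1 →
      ∀ (u : V) (x : X), ∑ σ ∈ homSet R S T, (if σ u = x then (1:ℝ) else 0) ≤ D ^ k := by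
  induction k with
  | zero =>
    intro V _ T hT hk u x
    have : Subsingleton V := Fintype.card_le_one_iff_subsingleton.mp (by omega)
    rw [← Finset.sum_filter, Finset.sum_const, nsmul_eq_mul, mul_one, pow_zero]
    have : ((homSet R S T).filter (fun σ => σ u = x)).card ≤ 1 := by
      rw [Finset.card_le_one]
      intro a ha b hb
      simp only [mem_filter] at ha hb
      funext j
      rw [Subsingleton.elim j u, ha.2, hb.2]
    exact_mod_cast this
  | succ k ih =>
    intro V _ T hT hk u x
    obtain ⟨v, w, hvu, hwv, hvw, huniq, hT', hk'⟩ := tree_leaf T hT k hk u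
    have hpeel := homSet_peel R hR S T v w hwv hvw huniq
      (fun σ => if σ ⟨u, hvu.symm⟩ = x then (1:ℝ) else 0)
    simp only at hpeel
    rw [hpeel]
    have hih := ih _ _ hT' hk' ⟨u, hvu.symm⟩ x
    calc _ ≤ ∑ σ ∈ homSet R S (T.comap (Subtype.val : {j // j ≠ v} → V)),
          (if σ ⟨u, hvu.symm⟩ = x then (1:ℝ) else 0) * D := by
          refine Finset.sum_le_sum fun σ hσ => ?_
          refine mul_le_mul_of_nonneg_left (hD _ ?_) (by split_ifs <;> norm_num)
          simp only [homSet, mem_filter] at hσ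
          exact hσ.2.1 _
      _ = (∑ σ ∈ homSet R S (T.comap (Subtype.val : {j // j ≠ v} → V)),
          (if σ ⟨u, hvu.symm⟩ = x then (1:ℝ) else 0)) * D := by rw [Finset.sum_mul]
      _ ≤ D ^ k * D := mul_le_mul_of_nonneg_right hih hD0
      _ = _ := by ring

theorem homSet_count (R : X → X → Prop) (hR : ∀ x y, R x y → R y x) (S : Finset X)
    (B p : ℝ) (hB : 0 ≤ B) (hp : 0 ≤ p)
    (hD : ∀ x ∈ S, ((S.filter (fun y => R x y)).card : ℝ) ≤ 2 * B)
    (hpB : p * S.card ≤ B) (k : ℕ) :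
    ∀ (V : Type) [Fintype V] (T : SimpleGraph V), T.IsTree → Fintype.card V = k + 1 →
      B * |((homSet R S T).card : ℝ) - p ^ k * (S.card : ℝ) ^ (k + 1)| ≤
        (∑ x ∈ S, |((S.filter (fun y => R x y)).card : ℝ) - p * S.card|) * ((2 ^ k - 1) * B ^ k) := by
  set A := ∑ x ∈ S, |((S.filter (fun y => R x y)).card : ℝ) - p * S.card| with hA
  have hA0 : 0 ≤ A := Finset.sum_nonneg fun _ _ => abs_nonneg _
  induction k with
  | zero =>
    intro V _ T hT hk
    have : Subsingleton V := Fintype.card_le_one_iff_subsingleton.mp (by omega)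
    have : (homSet R S T).card = S.card := by
      obtain ⟨v0⟩ : Nonempty V := Fintype.card_pos_iff.mp (by omega)
      apply Finset.card_bij (fun σ _ => σ v0)
      · intro σ hσ
        simp only [homSet, mem_filter] at hσ
        exact hσ.2.1 _
      · intro a _ b _ h
        funext j
        rw [Subsingleton.elim j v0]; exact h
      · intro x hx
        refine ⟨fun _ => x, ?_, rfl⟩
        simp only [homSet, mem_filter, mem_univ, true_and]
        refine ⟨fun _ => hx, fun a b hab => ?_⟩
        exact absurd (Subsingleton.elim a b) hab.ne
    rw [this]; simp
  | succ k ih =>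
    intro V _ T hT hk
    obtain ⟨u⟩ : Nonempty V := Fintype.card_pos_iff.mp (by omega)
    obtain ⟨v, w, hvu, hwv, hvw, huniq, hT', hk'⟩ := tree_leaf T hT k hk u
    have hpeel := homSet_peel R hR S T v w hwv hvw huniq (fun _ => 1)
    set T' := T.comap (Subtype.val : {j // j ≠ v} → V) with hT'def
    simp only [Finset.sum_const, nsmul_eq_mul, mul_one, one_mul] at hpeel
    have hih := ih _ _ hT' hk'
    set w' : {j // j ≠ v} := ⟨w, hwv⟩
    let e : X → ℝ := fun x => ((S.filter (fun y => R x y)).card : ℝ) - p * S.card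
    have h1 : ((homSet R S T).card : ℝ) - p * S.card * (homSet R S T').card
        = ∑ σ ∈ homSet R S T', e (σ w') := by
      rw [hpeel]
      simp only [e, Finset.sum_sub_distrib, Finset.sum_const, nsmul_eq_mul]
      ring
    have h2 : ∑ σ ∈ homSet R S T', |e (σ w')| ≤ (2 * B) ^ k * A := by
      calc ∑ σ ∈ homSet R S T', |e (σ w')|
          = ∑ σ ∈ homSet R S T', ∑ x ∈ S, (if σ w' = x then (1:ℝ) else 0) * |e x| := by
            refine Finset.sum_congr rfl fun σ hσ => ?_
            simp only [homSet, mem_filter] at hσ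
            simp [hσ.2.1 w']
        _ = ∑ x ∈ S, (∑ σ ∈ homSet R S T', (if σ w' = x then (1:ℝ) else 0)) * |e x| := by
            rw [Finset.sum_comm]
            refine Finset.sum_congr rfl fun x _ => ?_
            rw [Finset.sum_mul]
        _ ≤ ∑ x ∈ S, (2 * B) ^ k * |e x| := by
            refine Finset.sum_le_sum fun x _ => ?_
            exact mul_le_mul_of_nonneg_right
              (homSet_fiber R hR S (2 * B) (by positivity) hD k _ T' hT' hk' w' x) (abs_nonneg _)
        _ = _ := by rw [← Finset.mul_sum]
    have h3 : |((homSet R S T).card : ℝ) - p * S.card * (homSet R S T').card| ≤ (2 * B) ^ k * A := by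
      rw [h1]; exact (Finset.abs_sum_le_sum_abs _ _).trans h2
    have hps : 0 ≤ p * S.card := by positivity
    have h4 : |((homSet R S T).card : ℝ) - p ^ (k+1) * (S.card : ℝ) ^ (k + 1 + 1)|
        ≤ (2 * B) ^ k * A
          + B * |((homSet R S T').card : ℝ) - p ^ k * (S.card : ℝ) ^ (k + 1)| := by
      have : ((homSet R S T).card : ℝ) - p ^ (k+1) * (S.card : ℝ) ^ (k + 1 + 1)
          = (((homSet R S T).card : ℝ) - p * S.card * (homSet R S T').card)
            + p * S.card * (((homSet R S T').card : ℝ) - p ^ k * (S.card : ℝ) ^ (k + 1)) := by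
        ring
      rw [this]
      refine (abs_add_le _ _).trans (add_le_add h3 ?_)
      rw [abs_mul, abs_of_nonneg hps]
      exact mul_le_mul_of_nonneg_right hpB (abs_nonneg _)
    calc _ ≤ B * ((2 * B) ^ k * A
          + B * |((homSet R S T').card : ℝ) - p ^ k * (S.card : ℝ) ^ (k + 1)|) :=
          mul_le_mul_of_nonneg_left h4 hB
      _ ≤ B * ((2 * B) ^ k * A + A * ((2 ^ k - 1) * B ^ k)) := by gcongr
      _ = _ := by rw [mul_pow]; ring
end T

theorem aux_Q (r : ℕ) (hr : 1 ≤ r) (ε : ℝ) (hε : 0 < ε) : ∃ Q : ℕ, ∀ q : ℕ, Q ≤ q → 2 ≤ q →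
      ((2:ℝ) ^ r) * (q : ℝ) ^ (-ε) + (r + 1) * (q : ℝ) ^ (-(2 * ε))
        ≤ 8 * (q : ℝ) ^ (-(2 * ε / ((r : ℝ) + 1))) := by
  have hmono : ∀ q : ℕ, 2 ≤ q → (q : ℝ) ^ (-(2 * ε)) ≤ (q : ℝ) ^ (-ε) := by
    intro q hq
    apply Real.rpow_le_rpow_of_exponent_le
    · exact_mod_cast (by omega : 1 ≤ q)
    · linarith
  rcases Nat.lt_or_ge 1 r with h | h
  · set γ := ε - 2 * ε / ((r : ℝ) + 1) with hγ
    have hr' : (2:ℝ) ≤ r := by exact_mod_cast h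
    have hγ0 : 0 < γ := by
      rw [hγ, sub_pos, div_lt_iff₀ (by positivity)]
      nlinarith
    have htend : Filter.Tendsto (fun q : ℕ => ((2:ℝ) ^ r + (r + 1)) * (q : ℝ) ^ (-γ))
        Filter.atTop (nhds (((2:ℝ) ^ r + (r + 1)) * 0)) :=
      ((tendsto_rpow_neg_atTop hγ0).comp tendsto_natCast_atTop_atTop).const_mul _
    rw [mul_zero] at htend
    have hev := htend.eventually (gt_mem_nhds (by norm_num : (0:ℝ) < 8))
    obtain ⟨Q, hQ⟩ := Filter.eventually_atTop.mp hev
    refine ⟨Q, fun q hq hq2 => ?_⟩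
    have h1 := hQ q hq
    have hq0 : (0:ℝ) < q := by exact_mod_cast (by omega : 0 < q)
    have hsplit : (q : ℝ) ^ (-ε) = (q : ℝ) ^ (-γ) * (q : ℝ) ^ (-(2 * ε / ((r : ℝ) + 1))) := by
      rw [← Real.rpow_add hq0]; congr 1; rw [hγ]; ring
    have hg0 := Real.rpow_pos_of_pos hq0 (-(2 * ε / ((r : ℝ) + 1)))
    calc _ ≤ (2:ℝ) ^ r * (q : ℝ) ^ (-ε) + (r + 1) * (q : ℝ) ^ (-ε) := by
          exact add_le_add le_rfl (mul_le_mul_of_nonneg_left (hmono q hq2) (by positivity))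
      _ = (((2:ℝ) ^ r + (r + 1)) * (q : ℝ) ^ (-γ)) * (q : ℝ) ^ (-(2 * ε / ((r : ℝ) + 1))) := by
          rw [hsplit]; ring
      _ ≤ _ := mul_le_mul_of_nonneg_right h1.le hg0.le
  · have : r = 1 := by omega
    subst this
    refine ⟨0, fun q _ hq2 => ?_⟩
    have h1 := hmono q hq2
    have h2 : -(2 * ε / (((1:ℕ) : ℝ) + 1)) = -ε := by push_cast; ring
    rw [h2]
    have h3 : (0:ℝ) < (q : ℝ) ^ (-ε) :=
      Real.rpow_pos_of_pos (by exact_mod_cast (by omega : 0 < q)) _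
    push_cast
    linarith

theorem tree_core (d : ℕ) (hd : 2 ≤ d) (r : ℕ) (ε : ℝ) (hε : 0 < ε)
    (V : Type) [Fintype V] (T : SimpleGraph V) (hT : T.IsTree) (hV : Fintype.card V = r + 1)
    (F : Type) [Field F] [Fintype F] (t : F) (ht : t ≠ 0) (E : Finset (Fin d → F))
    (hq2 : 2 ≤ Fintype.card F)
    (hfin : ((2:ℝ) ^ r) * (Fintype.card F : ℝ) ^ (-ε)
        + (r + 1) * (Fintype.card F : ℝ) ^ (-(2 * ε))
        ≤ 8 * (Fintype.card F : ℝ) ^ (-(2 * ε / ((r : ℝ) + 1))))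
    (hE : (Fintype.card F : ℝ) ^ (((d : ℝ) + 1) / 2 + ε) < (E.card : ℝ)) :
    ∃ E' : Finset (Fin d → F), E' ⊆ E ∧
        ((E \ E').card : ℝ) ≤
          2 * (Fintype.card F : ℝ) ^ (-(2 * ε / ((r : ℝ) + 1))) * (E.card : ℝ) ∧
        |((homSet (fun x y : Fin d → F => x ⬝ᵥ y = t) E' T).card : ℝ) -
            (E.card : ℝ) ^ (r + 1) / (Fintype.card F : ℝ) ^ r| ≤
          8 * ((E.card : ℝ) ^ (r + 1) / (Fintype.card F : ℝ) ^ r) *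
            (Fintype.card F : ℝ) ^ (-(2 * ε / ((r : ℝ) + 1))) := by
  have hmix := fun S : Finset (Fin d → F) => aux_mixing hd t ht S
  have hq1 : (1:ℝ) < (Fintype.card F : ℝ) := by exact_mod_cast hq2
  generalize (Fintype.card F : ℝ) = q at *
  have hq0 : 0 < q := by linarith
  set h := q ^ (-ε) with hh
  set b := q ^ (-(2 * ε)) with hb
  set g := q ^ (-(2 * ε / ((r : ℝ) + 1))) with hg
  have hh0 : 0 < h := Real.rpow_pos_of_pos hq0 _
  have hb0 : 0 < b := Real.rpow_pos_of_pos hq0 _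
  have hg0 : 0 < g := Real.rpow_pos_of_pos hq0 _
  have hhb : h ^ 2 = b := by
    rw [hh, hb, ← Real.rpow_natCast, ← Real.rpow_mul hq0.le]; congr 1; push_cast; ring
  have hb1 : b ≤ 1 := Real.rpow_le_one_of_one_le_of_nonpos hq1.le (by linarith)
  have hbg : b ≤ g := by
    apply Real.rpow_le_rpow_of_exponent_le hq1.le
    rw [neg_le_neg_iff]
    apply div_le_self (by positivity)
    have : (0:ℝ) ≤ r := by positivity
    linarith
  set N : ℝ := (E.card : ℝ) with hN
  have hN0 : 0 < N := lt_trans (Real.rpow_pos_of_pos hq0 _) hE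
  have hNb : q ^ (d + 1) ≤ N ^ 2 * b := by
    have h1 : (q ^ (((d : ℝ) + 1) / 2 + ε)) ^ 2 ≤ N ^ 2 :=
      pow_le_pow_left₀ (Real.rpow_nonneg hq0.le _) hE.le 2
    have h2 : (q ^ (((d : ℝ) + 1) / 2 + ε)) ^ 2 * b = q ^ (d + 1) := by
      rw [hb, ← Real.rpow_natCast (q ^ _), ← Real.rpow_mul hq0.le, ← Real.rpow_add hq0,
        ← Real.rpow_natCast q]
      congr 1; push_cast; ring
    rw [← h2]
    exact mul_le_mul_of_nonneg_right h1 hb0.le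
  have hqd : q ^ (d + 1) = q ^ (d - 1) * q ^ 2 := by
    rw [← pow_add]; congr 1; omega
  set B := N / q with hB
  have hB0 : 0 < B := by positivity
  have hBq : B * q = N := by rw [hB]; field_simp
  have hqB : q ^ (d - 1) ≤ B ^ 2 * b := by
    rw [hqd, ← hBq] at hNb
    have : q ^ (d - 1) * q ^ 2 ≤ (B ^ 2 * b) * q ^ 2 := by linarith
    exact le_of_mul_le_mul_right this (by positivity)
  let ν : (Fin d → F) → ℝ := fun x => ((E.filter (fun y => x ⬝ᵥ y = t)).card : ℝ)
  refine ⟨E.filter (fun x => ν x ≤ 2 * B), Finset.filter_subset _ _, ?_, ?_⟩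
  all_goals
    have hsd : ((E \ E.filter (fun x => ν x ≤ 2 * B)).card : ℝ) ≤ b * N := by
      set Z := E \ E.filter (fun x => ν x ≤ 2 * B) with hZ
      have h1 : (Z.card : ℝ) * B ^ 2 ≤ N * q ^ (d - 1) := by
        calc (Z.card : ℝ) * B ^ 2 = ∑ x ∈ Z, B ^ 2 := by simp
          _ ≤ ∑ x ∈ Z, (ν x - B) ^ 2 := by
              refine Finset.sum_le_sum fun x hx => ?_
              have : 2 * B < ν x := by
                by_contra hcon
                simp only [hZ, mem_sdiff, mem_filter, not_and] at hx
                exact hx.2 hx.1 (not_lt.mp hcon)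
              exact pow_le_pow_left₀ hB0.le (by linarith) 2
          _ ≤ ∑ x, (ν x - B) ^ 2 :=
              Finset.sum_le_sum_of_subset_of_nonneg (Finset.subset_univ _)
                (fun _ _ _ => sq_nonneg _)
          _ ≤ _ := hmix E
      have h2 : (Z.card : ℝ) * B ^ 2 ≤ (b * N) * B ^ 2 := by
        have := mul_le_mul_of_nonneg_left hqB hN0.le
        linarith
      exact le_of_mul_le_mul_right h2 (by positivity)
  · have := mul_le_mul_of_nonneg_right hbg hN0.le
    have := mul_nonneg hg0.le hN0.le
    linarith
  · set E' := E.filter (fun x => ν x ≤ 2 * B) with hE'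
    set m : ℝ := (E'.card : ℝ) with hm
    have hsub : E' ⊆ E := Finset.filter_subset _ _
    have hmN : m ≤ N := by
      rw [hm, hN]; exact_mod_cast Finset.card_le_card hsub
    have hm0 : 0 ≤ m := by positivity
    have hmlow : N * (1 - b) ≤ m := by
      have hcs : ((E \ E').card : ℝ) = N - m := by
        rw [Finset.cast_card_sdiff hsub]
      rw [hcs] at hsd
      linarith
    have hD : ∀ x ∈ E', ((E'.filter (fun y => x ⬝ᵥ y = t)).card : ℝ) ≤ 2 * B := by
      intro x hx
      have h1 : ν x ≤ 2 * B := (Finset.mem_filter.mp hx).2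
      refine le_trans ?_ h1
      have := Finset.card_le_card (Finset.filter_subset_filter (fun y => x ⬝ᵥ y = t) hsub)
      exact (Nat.cast_le (α := ℝ)).mpr this
    have hpB : (1 / q) * E'.card ≤ B := by
      rw [hB, one_div, inv_mul_eq_div]
      exact div_le_div_of_nonneg_right hmN hq0.le
    have hmain := homSet_count (fun x y : Fin d → F => x ⬝ᵥ y = t)
      (fun x y hxy => by rw [dotProduct_comm]; exact hxy) E' B (1 / q) hB0.le (by positivity)
      hD hpB r V T hT hV
    set A := ∑ x ∈ E', |((E'.filter (fun y => x ⬝ᵥ y = t)).card : ℝ) - 1 / q * E'.card| with hA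
    set n : ℝ := ((homSet (fun x y : Fin d → F => x ⬝ᵥ y = t) E' T).card : ℝ)
    have hA2 : A ^ 2 ≤ (N * B * h) ^ 2 := by
      calc A ^ 2 ≤ m * ∑ x ∈ E', |((E'.filter (fun y => x ⬝ᵥ y = t)).card : ℝ)
            - 1 / q * E'.card| ^ 2 := sq_sum_le_card_mul_sum_sq
        _ ≤ m * ∑ x, (((E'.filter (fun y => x ⬝ᵥ y = t)).card : ℝ) - E'.card / q) ^ 2 := by
            refine mul_le_mul_of_nonneg_left ?_ hm0
            have : ∀ x, |((E'.filter (fun y => x ⬝ᵥ y = t)).card : ℝ) - 1 / q * E'.card| ^ 2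
              = (((E'.filter (fun y => x ⬝ᵥ y = t)).card : ℝ) - E'.card / q) ^ 2 := by
              intro x
              rw [sq_abs, one_div, inv_mul_eq_div]
            simp only [this]
            exact Finset.sum_le_sum_of_subset_of_nonneg (Finset.subset_univ _)
                (fun _ _ _ => sq_nonneg _)
        _ ≤ m * (m * q ^ (d - 1)) := mul_le_mul_of_nonneg_left (hmix E') hm0
        _ ≤ N * (N * (B ^ 2 * b)) := by gcongr
        _ = _ := by rw [← hhb]; ring
    have hAle : A ≤ N * B * h := (abs_le_of_sq_le_sq' hA2 (by positivity)).2
    have h5 : |n - (1 / q) ^ r * m ^ (r + 1)| ≤ 2 ^ r * h * (N * B ^ r) := by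
      have : B * |n - (1 / q) ^ r * m ^ (r + 1)| ≤ B * (2 ^ r * h * (N * B ^ r)) := by
        refine hmain.trans ?_
        calc A * ((2 ^ r - 1) * B ^ r) ≤ (N * B * h) * (2 ^ r * B ^ r) := by
              have h2r : (1:ℝ) ≤ 2 ^ r := one_le_pow₀ (by norm_num)
              refine mul_le_mul hAle ?_ (mul_nonneg (by linarith) (by positivity)) (by positivity)
              refine mul_le_mul_of_nonneg_right (by linarith) (by positivity)
          _ = _ := by ring
      exact le_of_mul_le_mul_left this hB0
    have hMB : N ^ (r + 1) / q ^ r = N * B ^ r := by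
      rw [hB, div_pow]; ring
    have h6 : |(1 / q) ^ r * m ^ (r + 1) - N ^ (r + 1) / q ^ r| ≤ (r + 1) * b * (N * B ^ r) := by
      have hup : m ^ (r + 1) ≤ N ^ (r + 1) := pow_le_pow_left₀ hm0 hmN _
      have hlow : N ^ (r + 1) * (1 - (r + 1) * b) ≤ m ^ (r + 1) := by
        have h1 : 1 + ((r + 1 : ℕ) : ℝ) * (-b) ≤ (1 + -b) ^ (r + 1) :=
          one_add_mul_le_pow (by linarith) _
        have h2 : (N * (1 - b)) ^ (r + 1) ≤ m ^ (r + 1) :=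
          pow_le_pow_left₀ (mul_nonneg hN0.le (by linarith)) hmlow _
        rw [mul_pow] at h2
        refine le_trans (mul_le_mul_of_nonneg_left ?_ (by positivity)) h2
        rw [sub_eq_add_neg 1 b]
        refine le_trans (le_of_eq ?_) h1
        push_cast; ring
      have e1 : (1 / q) ^ r * m ^ (r + 1) - N ^ (r + 1) / q ^ r
          = (m ^ (r + 1) - N ^ (r + 1)) / q ^ r := by
        rw [one_div, inv_pow]; ring
      rw [← hMB, e1, abs_div, abs_of_pos (pow_pos hq0 r), abs_of_nonpos (by linarith),
        ← mul_div_assoc]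
      apply div_le_div_of_nonneg_right _ (pow_pos hq0 r).le
      linarith
    calc _ ≤ |n - (1 / q) ^ r * m ^ (r + 1)| + |(1 / q) ^ r * m ^ (r + 1) - N ^ (r + 1) / q ^ r| :=
          abs_sub_le _ _ _
      _ ≤ (2 ^ r * h + (r + 1) * b) * (N * B ^ r) := by linarith
      _ ≤ (8 * g) * (N * B ^ r) := mul_le_mul_of_nonneg_right hfin (by positivity)
      _ = _ := by rw [hMB]; ring

theorem tree_count_prod (d : ℕ) (hd : 2 ≤ d) (r : ℕ) (hr : 1 ≤ r) (ε : ℝ) (hε : 0 < ε) :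
    ∃ Q : ℕ, ∀ (V : Type) [Fintype V] [DecidableEq V] (T : SimpleGraph V),
      T.IsTree → Fintype.card V = r + 1 →
      ∀ (F : Type) [Field F] [Fintype F] [DecidableEq F],
      Q ≤ Fintype.card F → ∀ t : F, t ≠ 0 → ∀ E : Finset (Fin d → F),
      (Fintype.card F : ℝ) ^ (((d : ℝ) + 1) / 2 + ε) < (E.card : ℝ) →
      ∃ E' : Finset (Fin d → F), E' ⊆ E ∧
        ((E \ E').card : ℝ) ≤
          2 * (Fintype.card F : ℝ) ^ (-(2 * ε / ((r : ℝ) + 1))) * (E.card : ℝ) ∧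
        |(treeCountProd F d t V T E' : ℝ) -
            (E.card : ℝ) ^ (r + 1) / (Fintype.card F : ℝ) ^ r| ≤
          8 * ((E.card : ℝ) ^ (r + 1) / (Fintype.card F : ℝ) ^ r) *
            (Fintype.card F : ℝ) ^ (-(2 * ε / ((r : ℝ) + 1))) := by
  obtain ⟨Q, hQ⟩ : ∃ Q : ℕ, ∀ q : ℕ, Q ≤ q → 2 ≤ q →
      ((2:ℝ) ^ r) * (q : ℝ) ^ (-ε) + (r + 1) * (q : ℝ) ^ (-(2 * ε))
        ≤ 8 * (q : ℝ) ^ (-(2 * ε / ((r : ℝ) + 1))) := aux_Q r hr ε hε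
  refine ⟨Q, ?_⟩
  intro V _ _ T hT hV F _ _ _ hQF t ht E hE
  have hq2 : 2 ≤ Fintype.card F := Fintype.one_lt_card
  have hfin := hQ _ hQF hq2
  have hcount : ∀ E' : Finset (Fin d → F), treeCountProd F d t V T E'
      = (homSet (fun x y : Fin d → F => x ⬝ᵥ y = t) E' T).card := by
    intro E'
    unfold treeCountProd
    refine congrArg Finset.card (Finset.ext fun σ => ?_)
    rw [mem_homSet, Finset.mem_filter]
    exact ⟨fun h => h.2, fun h => ⟨Finset.mem_univ _, h⟩⟩
  simp only [hcount]
  obtain ⟨E', h1, h2, h3⟩ := tree_core d hd r ε hε V T hT hV F t ht E hq2 hfin hE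
  refine ⟨E', h1, ?_, h3⟩
  convert h2
end

section
/- Let k ≥ 1 be an integer. If |E| > (k/log 2)·q^{(d+1)/2}, then |P_k^prod(E) - |E|^{k+1}/q^k| ≤ (k/log 2)·q^{(d+1)/2}·|E|^k/q^k. -/
open Finset
open scoped Classical

/-- The number of paths of length `k` in the dot-product graph of `E`: tuples
`(x₀,…,x_k) ∈ E^{k+1}` with `x_{i-1} · x_i = t` for `i = 1,…,k`, where
`x·y = x₁y₁ + ⋯ + x_dy_d`. -/
noncomputable def pathCountProd (F : Type) [Field F] [Fintype F] [DecidableEq F]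
    (d k : ℕ) (t : F) (E : Finset (Fin d → F)) : ℕ :=
  (Finset.univ.filter (fun x : Fin (k + 1) → (Fin d → F) =>
    (∀ i, x i ∈ E) ∧ ∀ i : Fin k, ∑ j, x i.castSucc j * x i.succ j = t)).card

section aux
variable {F : Type} [Field F] [Fintype F] [DecidableEq F] {d : ℕ}

noncomputable def dI (t : F) (x y : Fin d → F) : ℝ := if ∑ j, x j * y j = t then 1 else 0

noncomputable def dW (t : F) (E : Finset (Fin d → F)) : ℕ → (Fin d → F) → ℝ
  | 0, x => if x ∈ E then 1 else 0
  | (k+1), x => if x ∈ E then ∑ y, dI t x y * dW t E k y else 0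

lemma dW_nonneg (t : F) (E : Finset (Fin d → F)) (k : ℕ) (x : Fin d → F) : 0 ≤ dW t E k x := by
  induction k generalizing x with
  | zero => unfold dW; split_ifs <;> norm_num
  | succ k ih =>
    unfold dW
    split_ifs
    · refine Finset.sum_nonneg fun y _ => mul_nonneg ?_ (ih y)
      unfold dI; split_ifs <;> norm_num
    · exact le_rfl

lemma dW_supp (t : F) (E : Finset (Fin d → F)) (k : ℕ) (x : Fin d → F) :
    (if x ∈ E then (1:ℝ) else 0) * dW t E k x = dW t E k x := by
  cases k <;> unfold dW <;> split_ifs <;> simp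

lemma path_sum (t : F) (E : Finset (Fin d → F)) (k : ℕ) (h : (Fin d → F) → ℝ) :
    ∑ x : Fin (k + 1) → (Fin d → F), h (x 0) * (if ((∀ i, x i ∈ E) ∧
      ∀ i : Fin k, ∑ j, x i.castSucc j * x i.succ j = t) then (1:ℝ) else 0)
    = ∑ v, h v * dW t E k v := by
  induction k generalizing h with
  | zero =>
    rw [← (Equiv.funUnique (Fin 1) (Fin d → F)).symm.sum_comp]
    refine Finset.sum_congr rfl fun v _ => ?_
    simp [dW]
  | succ k ih =>
    rw [← (Fin.consEquiv (fun _ : Fin (k+2) => (Fin d → F))).sum_comp, Fintype.sum_prod_type]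
    refine Finset.sum_congr rfl fun v _ => ?_
    have key := ih (fun w => h v * ((if v ∈ E then 1 else 0) * dI t v w))
    have e2 : h v * dW t E (k+1) v
        = ∑ w, h v * ((if v ∈ E then 1 else 0) * dI t v w) * dW t E k w := by
      rw [dW]
      split_ifs
      · rw [Finset.mul_sum]
        exact Finset.sum_congr rfl fun w _ => by ring
      · simp
    rw [e2, ← key]
    refine Finset.sum_congr rfl fun x _ => ?_
    simp only [Fin.consEquiv, Equiv.coe_fn_mk, Fin.cons_zero, Fin.forall_fin_succ (n := k+1),
      Fin.cons_succ, Fin.forall_fin_succ (n := k), Fin.castSucc_zero, ← Fin.succ_castSucc, dI]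
    by_cases h1 : v ∈ E <;> by_cases h2 : ∑ j, v j * x 0 j = t <;> simp [h1, h2, Fin.forall_fin_succ]

lemma path_eq (t : F) (E : Finset (Fin d → F)) (k : ℕ) :
    (pathCountProd F d k t E : ℝ) = ∑ v, dW t E k v := by
  have := path_sum t E k (fun _ => 1)
  simp only [one_mul] at this
  rw [← this, pathCountProd, Finset.sum_boole]

/-- Fibres of a surjective additive hom. -/
lemma fiber_card {V W : Type} [AddCommGroup V] [AddCommGroup W] [Fintype V] [Fintype W]
    (φ : V →+ W) (hφ : Function.Surjective φ) (w : W) :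
    (Fintype.card W : ℝ) * (∑ x : V, if φ x = w then (1:ℝ) else 0) = Fintype.card V := by
  have h1 : ∀ w' : W, (∑ x : V, if φ x = w' then (1:ℝ) else 0)
      = ∑ x : V, if φ x = w then (1:ℝ) else 0 := by
    intro w'
    obtain ⟨u, hu⟩ := hφ (w' - w)
    rw [← Equiv.sum_comp (Equiv.addRight u)]
    refine Finset.sum_congr rfl fun x _ => ?_
    simp only [Equiv.coe_addRight, map_add, hu]
    congr 1
    simp only [eq_iff_iff]
    constructor
    · intro h
      have := congrArg (fun z => z - (w' - w)) h
      simpa using this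
    · intro h; rw [h]; abel
  have h2 : ∑ w' : W, (∑ x : V, if φ x = w' then (1:ℝ) else 0) = Fintype.card V := by
    rw [Finset.sum_comm]; simp
  rw [← h2, Finset.sum_congr rfl (fun w' _ => h1 w')]
  simp

def dotHom (y : Fin d → F) : (Fin d → F) →+ F where
  toFun x := ∑ j, x j * y j
  map_zero' := by simp
  map_add' := by intro a b; simp [add_mul, Finset.sum_add_distrib]

lemma dot_smul (c : F) (x y : Fin d → F) : dotHom y (c • x) = c * dotHom y x := by
  simp [dotHom, Finset.mul_sum, mul_assoc]

lemma exists_dot {y : Fin d → F} (hy : y ≠ 0) : ∃ w, dotHom y w ≠ 0 := by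
  obtain ⟨i, hi⟩ := Function.ne_iff.mp hy
  refine ⟨Pi.single i 1, ?_⟩
  simpa [dotHom, Pi.single_apply] using hi

lemma count_one (t : F) {y : Fin d → F} (hy : y ≠ 0) :
    (Fintype.card F : ℝ) * ∑ x, dI t x y = (Fintype.card F : ℝ) ^ d := by
  obtain ⟨w, hw⟩ := exists_dot hy
  have := fiber_card (dotHom y) (fun c => ⟨(c / dotHom y w) • w, by
    rw [dot_smul]; field_simp⟩) t
  simp only [Fintype.card_pi, Finset.prod_const, Finset.card_univ,
    Fintype.card_fin, Nat.cast_pow] at this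
  rw [← this]
  congr 1
  refine Finset.sum_congr rfl fun x _ => ?_
  have hd2 : dotHom y x = ∑ j, x j * y j := rfl
  unfold dI
  rw [← hd2]
  congr!

lemma count_zero {t : F} (ht : t ≠ 0) (x : Fin d → F) : dI t x 0 = 0 := by
  simp [dI, ht.symm]

lemma count_two {t : F} (ht : t ≠ 0) {y z : Fin d → F} (hyz : y ≠ z) :
    (Fintype.card F : ℝ) ^ 2 * ∑ x, dI t x y * dI t x z ≤ (Fintype.card F : ℝ) ^ d := by
  by_cases hx : ∃ x0, dotHom y x0 = t ∧ dotHom z x0 = t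
  · obtain ⟨x0, h1, h2⟩ := hx
    have hsub : ∀ x, dotHom (z - y) x = dotHom z x - dotHom y x := by
      intro x; simp [dotHom, mul_sub]
    obtain ⟨w0, hw0⟩ := exists_dot (sub_ne_zero.mpr hyz.symm)
    set w := w0 - (dotHom y w0 / t) • x0 with hw
    have hwy : dotHom y w = 0 := by
      rw [hw, map_sub, dot_smul, h1]; field_simp; ring
    have hwz : dotHom z w = dotHom (z - y) w0 := by
      rw [hw, map_sub, dot_smul, h2, hsub]; field_simp
    set c := dotHom (z - y) w0
    have := fiber_card ((dotHom y).prod (dotHom z)) (fun p =>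
      ⟨(p.1 / t) • x0 + ((p.2 - p.1) / c) • w, by
        ext
        · simp only [AddMonoidHom.prod_apply, map_add, dot_smul, h1, hwy, Prod.fst_add]; field_simp; ring
        · simp only [AddMonoidHom.prod_apply, map_add, dot_smul, h2, hwz, Prod.snd_add]; field_simp; ring⟩) (t, t)
    have e : ∀ x, dI t x y * dI t x z
        = if ((dotHom y).prod (dotHom z)) x = (t, t) then (1:ℝ) else 0 := by
      intro x
      simp only [dI, AddMonoidHom.prod_apply, Prod.mk.injEq, dotHom, AddMonoidHom.coe_mk,
        ZeroHom.coe_mk]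
      split_ifs <;> simp_all
    rw [Finset.sum_congr rfl (fun x _ => e x)]
    simp only [Fintype.card_prod, Fintype.card_pi, Finset.prod_const, Finset.card_univ,
      Fintype.card_fin, Nat.cast_mul, Nat.cast_pow] at this
    rw [sq, ← this]
    apply le_of_eq
    congr!
  · have e : ∀ x, dI t x y * dI t x z = 0 := by
      intro x
      by_contra hne
      apply hx
      refine ⟨x, ?_⟩
      unfold dI at hne
      simpa [dotHom, and_comm] using hne
    rw [Finset.sum_congr rfl (fun x _ => e x)]
    simp

lemma kernel_bound {t : F} (ht : t ≠ 0) (y z : Fin d → F) :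
    ∑ x, ((Fintype.card F : ℝ) * dI t x y - 1) * ((Fintype.card F : ℝ) * dI t x z - 1)
      ≤ if y = z then (Fintype.card F : ℝ) ^ (d + 1) else 0 := by
  have hq : (1:ℝ) ≤ Fintype.card F := by exact_mod_cast Fintype.card_pos
  have hexp : ∑ x, ((Fintype.card F : ℝ) * dI t x y - 1) * ((Fintype.card F : ℝ) * dI t x z - 1)
      = (Fintype.card F : ℝ) ^ 2 * ∑ x, dI t x y * dI t x z
        - (Fintype.card F : ℝ) * ∑ x, dI t x y - (Fintype.card F : ℝ) * ∑ x, dI t x z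
        + (Fintype.card F : ℝ) ^ d := by
    have hc : (Fintype.card F : ℝ) ^ d = ∑ x : Fin d → F, (1:ℝ) := by simp
    rw [hc, Finset.mul_sum, Finset.mul_sum, Finset.mul_sum, ← Finset.sum_sub_distrib,
      ← Finset.sum_sub_distrib, ← Finset.sum_add_distrib]
    exact Finset.sum_congr rfl fun x _ => by ring
  rw [hexp]
  have hpos : (0:ℝ) ≤ (Fintype.card F : ℝ) ^ d := by positivity
  split_ifs with h
  · subst h
    have e : ∀ x, dI t x y * dI t x y = dI t x y := by
      intro x; unfold dI; split_ifs <;> simp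
    rw [Finset.sum_congr rfl (fun x _ => e x)]
    by_cases hy : y = 0
    · subst hy
      simp only [count_zero ht, Finset.sum_const_zero]
      rw [pow_succ _ d]; nlinarith
    · have := count_one t hy
      rw [sq, mul_assoc, this, pow_succ]
      nlinarith
  · by_cases hy : y = 0
    · subst hy
      have := count_one t (Ne.symm h)
      simp only [count_zero ht, Finset.sum_const_zero, zero_mul, this]
      linarith
    · by_cases hz : z = 0
      · subst hz
        have := count_one t hy
        simp only [count_zero ht, Finset.sum_const_zero, mul_zero, this]
        linarith
      · rw [count_one t hy, count_one t hz]
        linarith [count_two ht h]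

lemma bilin {t : F} (ht : t ≠ 0) (f g : (Fin d → F) → ℝ) (hg : ∀ y, 0 ≤ g y) :
    ((Fintype.card F : ℝ) * (∑ x, f x * ∑ y, dI t x y * g y) - (∑ x, f x) * ∑ y, g y) ^ 2
     ≤ (Fintype.card F : ℝ) ^ (d + 1) * ((∑ x, f x ^ 2) * ∑ y, g y ^ 2) := by
  set q : ℝ := (Fintype.card F : ℝ) with hq
  set R : (Fin d → F) → ℝ := fun x => ∑ y, (q * dI t x y - 1) * g y with hR
  have h1 : q * (∑ x, f x * ∑ y, dI t x y * g y) - (∑ x, f x) * ∑ y, g y = ∑ x, f x * R x := by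
    rw [Finset.mul_sum, Finset.sum_mul, ← Finset.sum_sub_distrib]
    refine Finset.sum_congr rfl fun x _ => ?_
    simp only [hR, sub_mul, one_mul, Finset.sum_sub_distrib, mul_assoc]
    rw [← Finset.mul_sum]; ring
  have h2 : ∑ x, R x ^ 2 ≤ q ^ (d+1) * ∑ y, g y ^ 2 := by
    have : ∑ x, R x ^ 2 = ∑ y, ∑ z, g y * g z * ∑ x, (q * dI t x y - 1) * (q * dI t x z - 1) := by
      simp only [hR, sq, Finset.sum_mul_sum]
      simp only [Finset.mul_sum]
      rw [Finset.sum_comm]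
      refine Finset.sum_congr rfl fun y _ => ?_
      rw [Finset.sum_comm]
      refine Finset.sum_congr rfl fun z _ => ?_
      exact Finset.sum_congr rfl fun x _ => by ring
    rw [this]
    calc _ ≤ ∑ y, ∑ z, g y * g z * (if y = z then q ^ (d+1) else 0) := by
          refine Finset.sum_le_sum fun y _ => Finset.sum_le_sum fun z _ => ?_
          exact mul_le_mul_of_nonneg_left (kernel_bound ht y z) (mul_nonneg (hg y) (hg z))
      _ = _ := by
          rw [Finset.mul_sum]
          refine Finset.sum_congr rfl fun y _ => ?_
          simp; ring
  rw [h1]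
  calc _ ≤ (∑ x, f x ^ 2) * ∑ x, R x ^ 2 := Finset.sum_mul_sq_le_sq_mul_sq _ _ _
    _ ≤ (∑ x, f x ^ 2) * (q ^ (d+1) * ∑ y, g y ^ 2) :=
        mul_le_mul_of_nonneg_left h2 (Finset.sum_nonneg fun _ _ => sq_nonneg _)
    _ = _ := by ring

lemma bilin' {t : F} (ht : t ≠ 0) (f g : (Fin d → F) → ℝ) (hg : ∀ y, 0 ≤ g y)
    (L : ℝ) (hL : 0 ≤ L) (hL2 : L ^ 2 = (Fintype.card F : ℝ) ^ (d + 1)) :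
    |(Fintype.card F : ℝ) * (∑ x, f x * ∑ y, dI t x y * g y) - (∑ x, f x) * ∑ y, g y|
     ≤ L * (√(∑ x, f x ^ 2) * √(∑ y, g y ^ 2)) := by
  apply abs_le_of_sq_le_sq _ (by positivity)
  rw [mul_pow, mul_pow, Real.sq_sqrt (Finset.sum_nonneg fun _ _ => sq_nonneg _),
    Real.sq_sqrt (Finset.sum_nonneg fun _ _ => sq_nonneg _), hL2]
  exact bilin ht f g hg

lemma W_norm {t : F} (ht : t ≠ 0) (E : Finset (Fin d → F))
    (L : ℝ) (hL : 0 ≤ L) (hL2 : L ^ 2 = (Fintype.card F : ℝ) ^ (d + 1)) (k : ℕ) :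
    (Fintype.card F : ℝ) ^ k * √(∑ x, dW t E k x ^ 2) ≤ (E.card + L) ^ k * √(E.card : ℝ) := by
  induction k with
  | zero => simp [dW]
  | succ k ih =>
    set q : ℝ := (Fintype.card F : ℝ) with hq
    have hq0 : 0 ≤ q := Nat.cast_nonneg _
    have hqk : 0 ≤ q ^ k := by positivity
    have hsum : ∀ m, ∑ x, dW t E m x ≤ √(E.card : ℝ) * √(∑ x, dW t E m x ^ 2) := by
      intro m
      have := Finset.sum_mul_sq_le_sq_mul_sq Finset.univ
        (fun x => if x ∈ E then (1:ℝ) else 0) (dW t E m)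
      simp only [dW_supp] at this
      rw [← Real.sqrt_mul (Nat.cast_nonneg _)]
      apply Real.le_sqrt_of_sq_le
      refine this.trans (le_of_eq ?_)
      simp
    have hb := bilin' ht (dW t E (k+1)) (dW t E k) (dW_nonneg t E k) L hL hL2
    have e : ∑ x, dW t E (k+1) x * ∑ y, dI t x y * dW t E k y = ∑ x, dW t E (k+1) x ^ 2 := by
      refine Finset.sum_congr rfl fun x _ => ?_
      rw [dW]; split_ifs <;> ring
    rw [e] at hb
    have hb := (abs_le.mp hb).2
    have hs : ∀ m, 0 ≤ ∑ x, dW t E m x := fun m => Finset.sum_nonneg fun x _ => dW_nonneg t E m x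
    have hss : 0 ≤ ∑ x, dW t E (k+1) x ^ 2 := Finset.sum_nonneg fun _ _ => sq_nonneg _
    have hprod := mul_le_mul (hsum (k+1)) (hsum k) (hs k) (by positivity)
    set S := √(∑ x, dW t E (k+1) x ^ 2) with hS
    set T := √(∑ x, dW t E k x ^ 2) with hT
    have hS0 : 0 ≤ S := Real.sqrt_nonneg _
    have hT0 : 0 ≤ T := Real.sqrt_nonneg _
    have hS2 : ∑ x, dW t E (k+1) x ^ 2 = S * S := (Real.mul_self_sqrt hss).symm
    have hn : √(E.card : ℝ) * √(E.card : ℝ) = E.card := Real.mul_self_sqrt (Nat.cast_nonneg _)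
    have hnL : 0 ≤ (E.card : ℝ) + L := add_nonneg (Nat.cast_nonneg _) hL
    have hmain : q * S ≤ (E.card + L) * T := by
      rcases hS0.eq_or_lt with h0 | h0
      · rw [← h0, mul_zero]; exact mul_nonneg hnL hT0
      · refine le_of_mul_le_mul_right ?_ h0
        have : √(E.card : ℝ) * S * (√(E.card : ℝ) * T) = E.card * (S * T) := by
          linear_combination (S * T) * hn
        rw [hS2] at hb
        nlinarith
    calc q ^ (k+1) * S = q ^ k * (q * S) := by ring
      _ ≤ q ^ k * ((E.card + L) * T) := mul_le_mul_of_nonneg_left hmain hqk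
      _ = (E.card + L) * (q ^ k * T) := by ring
      _ ≤ (E.card + L) * ((E.card + L) ^ k * √(E.card : ℝ)) :=
          mul_le_mul_of_nonneg_left ih hnL
      _ = _ := by ring

lemma path_bound {t : F} (ht : t ≠ 0) (E : Finset (Fin d → F))
    (L : ℝ) (hL : 0 ≤ L) (hL2 : L ^ 2 = (Fintype.card F : ℝ) ^ (d + 1)) (k : ℕ) :
    |(Fintype.card F : ℝ) ^ k * ∑ x, dW t E k x - (E.card : ℝ) ^ (k+1)|
      ≤ E.card * ((E.card + L) ^ k - (E.card : ℝ) ^ k) := by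
  induction k with
  | zero => simp [dW]
  | succ k ih =>
    have hW := W_norm ht E L hL hL2 k
    have hb := bilin' ht (dW t E 0) (dW t E k) (dW_nonneg t E k) L hL hL2
    have e : ∑ x, dW t E 0 x * ∑ y, dI t x y * dW t E k y = ∑ x, dW t E (k+1) x := by
      refine Finset.sum_congr rfl fun x _ => ?_
      simp [dW]
    have e0 : ∑ x, dW t E 0 x = E.card := by simp [dW]
    have e1 : ∑ x, dW t E 0 x ^ 2 = E.card := by simp [dW]
    rw [e, e0, e1] at hb
    set q : ℝ := (Fintype.card F : ℝ) with hq
    set n : ℝ := (E.card : ℝ) with hnn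
    have hq0 : 0 ≤ q := Nat.cast_nonneg _
    have hn0 : 0 ≤ n := Nat.cast_nonneg _
    have hqk : 0 ≤ q ^ k := by positivity
    have hn : √n * √n = n := Real.mul_self_sqrt hn0
    have s1 : |q ^ k * (q * ∑ x, dW t E (k+1) x - n * ∑ x, dW t E k x)|
        ≤ L * n * (n + L) ^ k := by
      rw [abs_mul, abs_of_nonneg hqk]
      calc _ ≤ q ^ k * (L * (√n * √(∑ x, dW t E k x ^ 2))) :=
            mul_le_mul_of_nonneg_left hb hqk
        _ = L * √n * (q ^ k * √(∑ x, dW t E k x ^ 2)) := by ring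
        _ ≤ L * √n * ((n + L) ^ k * √n) := mul_le_mul_of_nonneg_left hW (by positivity)
        _ = L * (√n * √n) * (n + L) ^ k := by ring
        _ = _ := by rw [hn]
    have s2 : |n * (q ^ k * ∑ x, dW t E k x - n ^ (k+1))|
        ≤ n * (n * ((n + L) ^ k - n ^ k)) := by
      rw [abs_mul, abs_of_nonneg hn0]
      exact mul_le_mul_of_nonneg_left ih hn0
    calc _ = |q ^ k * (q * ∑ x, dW t E (k+1) x - n * ∑ x, dW t E k x)
          + n * (q ^ k * ∑ x, dW t E k x - n ^ (k+1))| := by congr 1; ring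
      _ ≤ _ := (abs_add_le _ _).trans (add_le_add s1 s2)
      _ = _ := by ring

lemma exp_chord {x : ℝ} (h0 : 0 ≤ x) (h1 : x ≤ Real.log 2) :
    Real.exp x - 1 ≤ x / Real.log 2 := by
  have hl : 0 < Real.log 2 := Real.log_pos (by norm_num)
  have h2 : x / Real.log 2 ≤ 1 := (div_le_one hl).mpr h1
  have := convexOn_exp.2 (Set.mem_univ 0) (Set.mem_univ (Real.log 2))
    (sub_nonneg.mpr h2) (div_nonneg h0 hl.le) (by ring)
  simp only [smul_eq_mul, mul_zero, zero_add, Real.exp_zero, mul_one,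
    div_mul_cancel₀ _ hl.ne', Real.exp_log (show (0:ℝ) < 2 by norm_num)] at this
  linarith

end aux

theorem path_count_prod (F : Type) [Field F] [Fintype F] [DecidableEq F]
    (d : ℕ) (hd : 2 ≤ d) (t : F) (ht : t ≠ 0) (E : Finset (Fin d → F))
    (q : ℝ) (hq : q = (Fintype.card F : ℝ))
    (k : ℕ) (hk : 1 ≤ k)
    (hsize : (k : ℝ) / Real.log 2 * q ^ (((d : ℝ) + 1) / 2) < (E.card : ℝ)) :
    |(pathCountProd F d k t E : ℝ) - (E.card : ℝ) ^ (k + 1) / q ^ k| ≤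
      (k : ℝ) / Real.log 2 * q ^ (((d : ℝ) + 1) / 2) * ((E.card : ℝ) ^ k / q ^ k) := by
  have hl : 0 < Real.log 2 := Real.log_pos (by norm_num)
  have hq0 : 0 < q := by rw [hq]; exact_mod_cast Fintype.card_pos
  set L : ℝ := q ^ (((d : ℝ) + 1) / 2) with hLdef
  have hL : 0 ≤ L := by positivity
  have hL2 : L ^ 2 = (Fintype.card F : ℝ) ^ (d + 1) := by
    rw [← hq, hLdef, ← Real.rpow_natCast, ← Real.rpow_mul hq0.le, ← Real.rpow_natCast]
    congr 1; push_cast; ring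
  have hb := path_bound ht E L hL hL2 k
  rw [← path_eq, ← hq] at hb
  set n : ℝ := (E.card : ℝ) with hn
  have hn0 : 0 < n := lt_of_le_of_lt (by positivity) hsize
  have hqk : 0 < q ^ k := by positivity
  have e1 : (pathCountProd F d k t E : ℝ) - n ^ (k + 1) / q ^ k
      = (q ^ k * (pathCountProd F d k t E : ℝ) - n ^ (k + 1)) / q ^ k := by
    field_simp
  rw [e1, abs_div, abs_of_pos hqk, ← mul_div_assoc]
  apply div_le_div_of_nonneg_right _ hqk.le
  refine hb.trans ?_
  have hx : (k : ℝ) * (L / n) ≤ Real.log 2 := by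
    rw [← mul_div_assoc, div_le_iff₀ hn0]
    have : (k : ℝ) / Real.log 2 * L = (k * L) / Real.log 2 := by ring
    rw [this, div_lt_iff₀ hl] at hsize
    linarith
  have h3 : (1 + L / n) ^ k ≤ Real.exp (k * (L / n)) := by
    rw [Real.exp_nat_mul]
    apply pow_le_pow_left₀ (by positivity)
    linarith [Real.add_one_le_exp (L / n)]
  have h4 := exp_chord (by positivity) hx
  have h5 : (n + L) ^ k = n ^ k * (1 + L / n) ^ k := by
    rw [← mul_pow]; congr 1; field_simp
  calc n * ((n + L) ^ k - n ^ k) = n * n ^ k * ((1 + L / n) ^ k - 1) := by rw [h5]; ring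
    _ ≤ n * n ^ k * (k * (L / n) / Real.log 2) := by
        apply mul_le_mul_of_nonneg_left _ (by positivity)
        linarith
    _ = k / Real.log 2 * L * n ^ k := by field_simp
end
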